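/- Let F be a good linear combination of Schur polynomials in m variables, with dominance-maxima forming a chain alpha = lambda^0 < ... < lambda^l = beta as in the definition of good. Then the Newton polytope of F has the integer decomposition property: for every positive integer t, every lattice point of t·Newton(F) is a sum of t lattice points of Newton(F). -/

import Mathlib

open Finset Pointwise

/-- The Young diagram of a partition with at most `m` parts given as an antitone map. -/
def diagramOf {m : ℕ} (lam : Fin m → ℕ) (h : Antitone lam) : YoungDiagram where
  cells := Finset.univ.biUnion fun i : Fin m =>
    (Finset.range (lam i)).image fun j => ((i : ℕ), j)
  isLowerSet := by
    rintro ⟨i₁, j₁⟩ ⟨i₂, j₂⟩ ⟨hi, hj⟩ hm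
    simp only [Finset.coe_biUnion, Finset.coe_univ, Set.mem_iUnion, Finset.mem_coe,
      Finset.mem_image, Finset.mem_range, Set.mem_univ, true_and, Set.iUnion_true] at hm ⊢
    obtain ⟨i, j, hj', hij⟩ := hm
    have hi1 : (i₁ : ℕ) = (i : ℕ) := ((Prod.mk.injEq _ _ _ _).mp hij).1.symm
    have hj1 : j₁ = j := ((Prod.mk.injEq _ _ _ _).mp hij).2.symm
    have hi2m : i₂ < m := lt_of_le_of_lt (le_of_le_of_eq hi hi1) i.isLt
    refine ⟨⟨i₂, hi2m⟩, j₂, ?_, rfl⟩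
    have : lam i ≤ lam ⟨i₂, hi2m⟩ := h (by simpa [Fin.le_def] using le_of_le_of_eq hi hi1)
    omega

/-- The content of a tableau: the number of cells with entry `e`. -/
def content (μ : YoungDiagram) (T : SemistandardYoungTableau μ) (e : ℕ) : ℕ :=
  (μ.cells.filter fun c => T c.1 c.2 = e).card

/-- The coefficient of `x^α` in the Schur polynomial `s_μ(x_1, …, x_m)`: the number of
semistandard Young tableaux of shape `μ` with entries in `{0, …, m-1}` and content `α`. -/
noncomputable def schurCoeff (m : ℕ) (μ : YoungDiagram) (α : Fin m → ℕ) : ℕ :=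
  Nat.card {T : SemistandardYoungTableau μ // (∀ i j : ℕ, (i, j) ∈ μ → T i j < m) ∧
    ∀ k : Fin m, content μ T (k : ℕ) = α k}

/-- The Schur polynomial, viewed as its coefficient function. -/
noncomputable def schurR (m : ℕ) (μ : YoungDiagram) : (Fin m → ℕ) → ℝ :=
  fun α => (schurCoeff m μ α : ℝ)

/-- The support of a polynomial (given by its coefficient function), as a set of points of `ℝ^m`. -/
def Supp {m : ℕ} (F : (Fin m → ℕ) → ℝ) : Set (Fin m → ℝ) :=
  {x | ∃ α : Fin m → ℕ, F α ≠ 0 ∧ x = fun i => (α i : ℝ)}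

/-- The Newton polytope of a polynomial. -/
def NewtonP {m : ℕ} (F : (Fin m → ℕ) → ℝ) : Set (Fin m → ℝ) :=
  convexHull ℝ (Supp F)

/-- A lattice point of `ℝ^m`. -/
def IsLattice {m : ℕ} (x : Fin m → ℝ) : Prop := ∀ i, ∃ z : ℤ, x i = z

/-- Saturated Newton polytope. -/
def HasSNP {m : ℕ} (F : (Fin m → ℕ) → ℝ) : Prop :=
  NewtonP F ∩ {x | IsLattice x} = Supp F

/-- Integer decomposition property of a subset of `ℝ^m`. -/
def HasIDP {m : ℕ} (P : Set (Fin m → ℝ)) : Prop :=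
  ∀ t : ℕ, 0 < t → ∀ p ∈ (t : ℝ) • P, IsLattice p →
    ∃ v : Fin t → (Fin m → ℝ), (∀ j, v j ∈ P ∧ IsLattice (v j)) ∧ p = ∑ j, v j

/-- `b` dominates `a`: every partial sum of `b` is at least that of `a`. -/
def Dominates {m : ℕ} (a b : Fin m → ℕ) : Prop :=
  ∀ j : Fin m, ∑ i ∈ Finset.univ.filter (· ≤ j), a i ≤ ∑ i ∈ Finset.univ.filter (· ≤ j), b i

/-- The `S_m`-orbit of a point of `ℕ^m`, as a subset of `ℝ^m`. -/
def orbitR {m : ℕ} (lam : Fin m → ℕ) : Set (Fin m → ℝ) :=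
  {x | ∃ σ : Equiv.Perm (Fin m), x = fun i => (lam (σ i) : ℝ)}

/-- Add a box to row `r`. -/
def AddBoxAt {m : ℕ} (ν : Fin m → ℕ) (r : Fin m) : Fin m → ℕ :=
  Function.update ν r (ν r + 1)

/-- `ν'` is obtained from `ν` by adding a box in the northmost row such that the result is
a partition that is at most `β`. -/
def NorthmostStep {m : ℕ} (β ν ν' : Fin m → ℕ) : Prop :=
  ∃ r : Fin m, ν' = AddBoxAt ν r ∧ Antitone ν' ∧ ν' ≤ β ∧
    ∀ r' : Fin m, r' < r → ¬ (Antitone (AddBoxAt ν r') ∧ AddBoxAt ν r' ≤ β)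

/-! ### Tableaux -/

lemma mem_diagramOf {m : ℕ} (lam : Fin m → ℕ) (h : Antitone lam) (i j : ℕ) :
    (i, j) ∈ diagramOf lam h ↔ ∃ hi : i < m, j < lam ⟨i, hi⟩ := by
  rw [← YoungDiagram.mem_cells]
  simp only [diagramOf, Finset.mem_biUnion, Finset.mem_univ, true_and, Finset.mem_image,
    Finset.mem_range, Prod.mk.injEq]
  constructor
  · rintro ⟨a, b, hb, rfl, rfl⟩
    exact ⟨a.2, hb⟩
  · rintro ⟨hi, hj⟩
    exact ⟨⟨i, hi⟩, j, hj, rfl, rfl⟩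

/-- sum of the first `k` entries -/
def pf {m : ℕ} {R : Type} [AddCommMonoid R] (k : ℕ) (f : Fin m → R) : R :=
  ∑ i ∈ Finset.univ.filter (fun i : Fin m => (i : ℕ) < k), f i

lemma card_rows_lt {m : ℕ} (lam : Fin m → ℕ) (h : Antitone lam) (k : ℕ) :
    ((diagramOf lam h).cells.filter (fun c => c.1 < k)).card = pf k lam := by
  have : (diagramOf lam h).cells.filter (fun c => c.1 < k) =
      (Finset.univ.filter (fun i : Fin m => (i : ℕ) < k)).biUnion fun i : Fin m =>
        (Finset.range (lam i)).image fun j => ((i : ℕ), j) := by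
    ext ⟨a, b⟩
    simp only [Finset.mem_filter, YoungDiagram.mem_cells, mem_diagramOf, Finset.mem_biUnion,
      Finset.mem_univ, true_and, Finset.mem_image, Finset.mem_range, Prod.mk.injEq]
    constructor
    · rintro ⟨⟨hi, hj⟩, hk⟩
      exact ⟨⟨a, hi⟩, hk, b, hj, rfl, rfl⟩
    · rintro ⟨i, hk, j, hj, rfl, rfl⟩
      exact ⟨⟨i.2, hj⟩, hk⟩
  rw [this, Finset.card_biUnion]
  · unfold pf
    apply Finset.sum_congr rfl
    intro i _
    rw [Finset.card_image_of_injective _ (fun a b hab => (Prod.mk.injEq _ _ _ _ ▸ hab).2)]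
    simp
  · intro a _ b _ hab
    rw [Function.onFun, Finset.disjoint_left]
    intro x hx hy
    simp only [Finset.mem_image] at hx hy
    obtain ⟨_, _, rfl⟩ := hx
    obtain ⟨_, _, h2⟩ := hy
    exact hab (Fin.ext ((Prod.mk.injEq _ _ _ _ ▸ h2).1).symm)

lemma content_le {m : ℕ} (lam : Fin m → ℕ) (h : Antitone lam) (α : Fin m → ℕ)
    (hne : schurCoeff m (diagramOf lam h) α ≠ 0) (S : Finset (Fin m)) :
    ∑ k ∈ S, α k ≤ pf S.card lam := by
  classical
  have hn : Nonempty {T : SemistandardYoungTableau (diagramOf lam h) //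
      (∀ i j : ℕ, (i, j) ∈ (diagramOf lam h) → T i j < m) ∧
      ∀ k : Fin m, content (diagramOf lam h) T (k : ℕ) = α k} := by
    by_contra hcon
    rw [not_nonempty_iff] at hcon
    exact hne (by unfold schurCoeff; exact Nat.card_of_isEmpty)
  obtain ⟨T, hT, hc⟩ := hn
  set S' : Finset ℕ := S.image (fun k : Fin m => (k : ℕ)) with hS'
  have hcard : S'.card = S.card := Finset.card_image_of_injective _ Fin.val_injective
  have h1 : ∑ k ∈ S, α k =
      ((diagramOf lam h).cells.filter (fun c => T c.1 c.2 ∈ S')).card := by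
    rw [Finset.card_eq_sum_card_fiberwise (f := fun c => T c.1 c.2) (t := S')]
    · rw [hS', Finset.sum_image (fun a _ b _ hab => Fin.val_injective hab)]
      apply Finset.sum_congr rfl
      intro k hk
      rw [← hc k, content]
      congr 1
      ext c
      simp only [Finset.mem_filter]
      constructor
      · rintro ⟨h1, h2⟩
        exact ⟨⟨h1, by rw [h2]; exact Finset.mem_image_of_mem _ hk⟩, h2⟩
      · rintro ⟨⟨h1, _⟩, h2⟩
        exact ⟨h1, h2⟩
    · intro c hc
      simpa using (Finset.mem_filter.mp hc).2
  rw [h1, ← card_rows_lt lam h]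
  apply Finset.card_le_card_of_injOn
    (fun c => (Nat.count (fun i => T i c.2 ∈ S') c.1, c.2))
  · rintro ⟨i, j⟩ hij
    simp only [Finset.coe_filter, Set.mem_ofPred_eq, YoungDiagram.mem_cells] at hij ⊢
    obtain ⟨hm, hs⟩ := hij
    refine ⟨(diagramOf lam h).up_left_mem (Nat.count_le _) le_rfl hm, ?_⟩
    rw [← hcard]
    have : Nat.count (fun i => T i j ∈ S') (i+1) ≤ S'.card := by
      rw [Nat.count_eq_card_filter_range]
      apply Finset.card_le_card_of_injOn (fun i => T i j)
      · intro a ha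
        simpa using (Finset.mem_filter.mp ha).2
      · intro a ha b hb hab
        have ha' : a < i + 1 := by simpa using (Finset.mem_filter.mp ha).1
        have hb' : b < i + 1 := by simpa using (Finset.mem_filter.mp hb).1
        by_contra hne
        rcases lt_or_gt_of_ne hne with hl | hl
        · exact absurd hab (T.col_strict hl
            ((diagramOf lam h).up_left_mem (by omega) le_rfl hm)).ne
        · exact absurd hab (T.col_strict hl
            ((diagramOf lam h).up_left_mem (by omega) le_rfl hm)).ne'
    rw [Nat.count_succ, if_pos hs] at this
    omega
  · rintro ⟨i, j⟩ hij ⟨i', j'⟩ hij' heq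
    simp only [Finset.coe_filter, Set.mem_ofPred_eq] at hij hij'
    simp only [Prod.mk.injEq] at heq
    obtain ⟨h1, rfl⟩ := heq
    rw [Nat.count_injective (p := fun i => T i j ∈ S') hij.2 hij'.2 h1]

lemma nth_facts (p : ℕ → Prop) [DecidablePred p] (n i : ℕ) (hi : i < Nat.count p n) :
    p (Nat.nth p i) ∧ Nat.count p (Nat.nth p i) = i ∧ Nat.nth p i < n := by
  have hh : ∀ hf : (Set.ofPred p).Finite, i < hf.toFinset.card := by
    intro hf
    refine lt_of_lt_of_le hi ?_
    rw [Nat.count_eq_card_filter_range]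
    apply Finset.card_le_card
    intro x hx
    rw [Set.Finite.mem_toFinset]
    exact (Finset.mem_filter.mp hx).2
  exact ⟨Nat.nth_mem _ hh, Nat.count_nth hh, Nat.nth_lt_of_lt_count hi⟩

lemma schurCoeff_perm {m : ℕ} (lam : Fin m → ℕ) (h : Antitone lam) (σ : Equiv.Perm (Fin m)) :
    schurCoeff m (diagramOf lam h) (fun k => lam (σ k)) ≠ 0 := by
  classical
  set μ := diagramOf lam h with hμ
  let p : ℕ → ℕ → Prop := fun j n => ∃ hn : n < m, j < lam (σ ⟨n, hn⟩)
  have hcol : ∀ i j, (i, j) ∈ μ ↔ i < Nat.count (p j) m := by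
    intro i j
    have h1 : Nat.count (p j) m = μ.colLen j := by
      have e1 : Nat.count (p j) m =
          (Finset.univ.filter (fun i : Fin m => (i : ℕ) < μ.colLen j)).card := by
        rw [Nat.count_eq_card_filter_range]
        symm
        apply Finset.card_bij (fun i _ => ((σ.symm i : Fin m) : ℕ))
        · intro a ha
          have := (Finset.mem_filter.mp ha).2
          rw [← YoungDiagram.mem_iff_lt_colLen, hμ, mem_diagramOf] at this
          simp only [Finset.mem_filter, Finset.mem_range]
          exact ⟨(σ.symm a).2, (σ.symm a).2, by simpa using this.2⟩
        · intro a _ b _ hab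
          exact σ.symm.injective (Fin.ext hab)
        · intro b hb
          obtain ⟨_, hb2, hb3⟩ := Finset.mem_filter.mp hb
          refine ⟨σ ⟨b, hb2⟩, ?_, by simp⟩
          simp only [Finset.mem_filter, Finset.mem_univ, true_and]
          rw [← YoungDiagram.mem_iff_lt_colLen, hμ, mem_diagramOf]
          exact ⟨(σ ⟨b, hb2⟩).2, hb3⟩
      rw [e1, Fin.card_filter_val_lt]
      apply min_eq_right
      by_contra hlt
      push Not at hlt
      rw [← YoungDiagram.mem_iff_lt_colLen, hμ, mem_diagramOf] at hlt
      exact absurd hlt.1 (lt_irrefl _)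
    rw [h1, YoungDiagram.mem_iff_lt_colLen]
  let T : SemistandardYoungTableau μ :=
    { entry := fun i j => if (i, j) ∈ μ then Nat.nth (p j) i else 0
      row_weak' := by
        intro i j1 j2 hj hm
        have hm1 : (i, j1) ∈ μ := μ.up_left_mem le_rfl hj.le hm
        rw [if_pos hm, if_pos hm1]
        obtain ⟨a1, a2, a3⟩ := nth_facts (p j2) m i ((hcol _ _).1 hm)
        apply Nat.lt_succ_iff.mp
        apply Nat.nth_lt_of_lt_count
        have : Nat.count (p j2) (Nat.nth (p j2) i + 1) ≤
            Nat.count (p j1) (Nat.nth (p j2) i + 1) := by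
          apply Nat.count_mono_left
          rintro k _ ⟨hk1, hk2⟩
          exact ⟨hk1, by omega⟩
        rw [Nat.count_succ, if_pos a1, a2] at this
        exact this
      col_strict' := by
        intro i1 i2 j hi hm
        have hm1 : (i1, j) ∈ μ := μ.up_left_mem hi.le le_rfl hm
        rw [if_pos hm, if_pos hm1]
        obtain ⟨a1, a2, a3⟩ := nth_facts (p j) m i2 ((hcol _ _).1 hm)
        apply Nat.nth_lt_of_lt_count
        rw [a2]; exact hi
      zeros' := by
        intro i j hm
        rw [if_neg hm] }
  have hT : ∀ i j, (i, j) ∈ μ → T i j = Nat.nth (p j) i := by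
    intro i j hm
    change (if (i, j) ∈ μ then Nat.nth (p j) i else 0) = _
    rw [if_pos hm]
  have hfin : Finite {T : SemistandardYoungTableau μ // (∀ i j : ℕ, (i, j) ∈ μ → T i j < m) ∧
      ∀ k : Fin m, content μ T (k : ℕ) = lam (σ k)} := by
    let φ : {T : SemistandardYoungTableau μ // (∀ i j : ℕ, (i, j) ∈ μ → T i j < m) ∧
      ∀ k : Fin m, content μ T (k : ℕ) = lam (σ k)} → (μ.cells → Fin m) :=
      fun T c => ⟨T.1 c.1.1 c.1.2, T.2.1 _ _ (by
        have := c.2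
        rwa [YoungDiagram.mem_cells] at this)⟩
    apply Finite.of_injective φ
    intro T1 T2 h12
    apply Subtype.ext
    apply SemistandardYoungTableau.ext
    intro i j
    by_cases hm : (i, j) ∈ μ
    · have := congrFun h12 ⟨(i, j), by rwa [YoungDiagram.mem_cells]⟩
      exact congrArg Fin.val this
    · rw [T1.1.zeros hm, T2.1.zeros hm]
  have hne : Nonempty {T : SemistandardYoungTableau μ // (∀ i j : ℕ, (i, j) ∈ μ → T i j < m) ∧
      ∀ k : Fin m, content μ T (k : ℕ) = lam (σ k)} := by
    refine ⟨T, ?_, ?_⟩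
    · intro i j hm
      rw [hT i j hm]
      exact (nth_facts (p j) m i ((hcol _ _).1 hm)).2.2
    · intro k
      rw [content, ← Finset.card_range (lam (σ k))]
      symm
      apply Finset.card_bij (fun j _ => (Nat.count (p j) (k : ℕ), j))
      · intro j hj
        have hp : p j k := ⟨k.2, by simpa using hj⟩
        have hm : (Nat.count (p j) (k : ℕ), j) ∈ μ := by
          rw [hcol]
          exact Nat.count_strict_mono hp k.2
        rw [Finset.mem_filter, YoungDiagram.mem_cells]
        refine ⟨hm, ?_⟩
        rw [hT _ _ hm]
        exact Nat.nth_count hp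
      · intro a _ b _ hab
        exact (Prod.mk.injEq _ _ _ _ ▸ hab).2
      · rintro ⟨i, j⟩ hij
        rw [Finset.mem_filter, YoungDiagram.mem_cells] at hij
        obtain ⟨hm, hk⟩ := hij
        simp only at hk
        rw [hT _ _ hm] at hk
        obtain ⟨a1, a2, a3⟩ := nth_facts (p j) m i ((hcol _ _).1 hm)
        rw [hk] at a1 a2
        exact ⟨j, by simpa using a1.2, by rw [a2]⟩
  unfold schurCoeff
  exact Nat.card_pos.ne'

/-! ### Transfers -/

lemma transfer {m : ℕ} (Y : Set (Fin m → ℤ))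
    (hY : ∀ y ∈ Y, ∀ a b, y b < y a → (y + Pi.single b 1 - Pi.single a 1) ∈ Y)
    (p : Fin m → ℤ) (hp : Antitone p) (n : ℕ) :
    ∀ y ∈ Y, (∀ k ≤ m, pf k p ≤ pf k y) → ∑ i, p i = ∑ i, y i →
      ∑ i, (y i - p i).natAbs ≤ n → p ∈ Y := by
  classical
  induction n with
  | zero =>
    intro y hy _ _ hn
    have : y = p := by
      funext i
      have := Finset.sum_eq_zero_iff.mp (Nat.le_zero.mp hn) i (Finset.mem_univ i)
      omega
    exact this ▸ hy
  | succ n ih =>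
    intro y hy hpf hsum hn
    by_cases hb : ∃ b, y b < p b
    · obtain ⟨b, hb, hbmin⟩ : ∃ b, y b < p b ∧ ∀ i < b, p i ≤ y i := by
        have hne : (Finset.univ.filter (fun b => y b < p b)).Nonempty := by
          obtain ⟨b, hb⟩ := hb
          exact ⟨b, by simp [hb]⟩
        refine ⟨Finset.min' _ hne, (Finset.mem_filter.mp (Finset.min'_mem _ hne)).2, ?_⟩
        intro i hi
        by_contra hlt
        push Not at hlt
        have := Finset.min'_le (Finset.univ.filter (fun b => y b < p b)) i (by simp [hlt])
        exact absurd hi (not_lt.mpr this)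
      obtain ⟨a, hab, ha⟩ : ∃ a, a < b ∧ p a < y a := by
        by_contra hcon
        push Not at hcon
        have h1 := hpf (b + 1) b.2
        refine absurd h1 (not_le.mpr ?_)
        unfold pf
        apply Finset.sum_lt_sum
        · intro i hi
          have hi' : (i : ℕ) < b + 1 := (Finset.mem_filter.mp hi).2
          rcases lt_or_eq_of_le (show i ≤ b from Nat.lt_succ_iff.mp hi') with h | h
          · exact hcon i h
          · rw [h]; exact hb.le
        · exact ⟨b, by simp, hb⟩
      have hpab := hp hab.le
      set y' := y + Pi.single b 1 - Pi.single a 1 with hy'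
      have hne : a ≠ b := hab.ne
      have hya : y' a = y a - 1 := by simp [hy', hne]
      have hyb : y' b = y b + 1 := by simp [hy', hne.symm]
      have hyo : ∀ i, i ≠ a → i ≠ b → y' i = y i := by
        intro i h1 h2; simp [hy', h1, h2]
      have hsS : ∀ S : Finset (Fin m), a ∈ S → b ∈ S → ∑ i ∈ S, y' i = ∑ i ∈ S, y i := by
        intro S h1 h2
        simp only [hy', Pi.add_apply, Pi.sub_apply, Finset.sum_sub_distrib, Finset.sum_add_distrib,
          Finset.sum_pi_single', h1, h2, if_true]
        ring
      apply ih y' (hY y hy a b (by omega))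
      · intro k hk
        by_cases hkb : (b : ℕ) < k
        · have := hpf k hk
          unfold pf at this ⊢
          rw [hsS _ (by simp; exact lt_trans hab hkb) (by simpa using hkb)]
          exact this
        · unfold pf
          apply Finset.sum_le_sum
          intro i hi
          have hi' : (i : ℕ) < k := (Finset.mem_filter.mp hi).2
          have hib : i < b := by rw [Fin.lt_def]; omega
          by_cases hia : i = a
          · rw [hia, hya]; omega
          · rw [hyo i hia hib.ne]; exact hbmin i hib
      · rw [hsS _ (Finset.mem_univ _) (Finset.mem_univ _)]; exact hsum
      · have : ∑ i, (y' i - p i).natAbs < ∑ i, (y i - p i).natAbs := by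
          apply Finset.sum_lt_sum
          · intro i _
            by_cases hia : i = a
            · rw [hia, hya]; omega
            · by_cases hib : i = b
              · rw [hib, hyb]; omega
              · rw [hyo i hia hib]
          · exact ⟨a, Finset.mem_univ _, by rw [hya]; omega⟩
        omega
    · push Not at hb
      have : p = y := by
        funext i
        exact (Finset.sum_eq_sum_iff_of_le (fun i _ => hb i)).mp hsum i (Finset.mem_univ i)
      exact this ▸ hy

/-! ### Permutohedra -/

lemma hull_perm {m : ℕ} (lam : Fin m → ℕ) (σ : Equiv.Perm (Fin m)) (x : Fin m → ℝ)
    (hx : x ∈ convexHull ℝ (orbitR lam)) : (fun i => x (σ i)) ∈ convexHull ℝ (orbitR lam) := by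
  have h1 : convexHull ℝ (orbitR lam) ⊆
      (LinearMap.funLeft ℝ ℝ σ) ⁻¹' (convexHull ℝ (orbitR lam)) := by
    apply convexHull_min
    · rintro _ ⟨τ, rfl⟩
      apply subset_convexHull
      exact ⟨σ.trans τ, by funext i; simp [LinearMap.funLeft]⟩
    · exact (convex_convexHull ℝ _).linear_preimage _
  exact h1 hx

lemma hull_transfer {m : ℕ} (lam : Fin m → ℕ) (v : Fin m → ℤ) (a b : Fin m) (hab : v b < v a)
    (hv : (fun i => (v i : ℝ)) ∈ convexHull ℝ (orbitR lam)) :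
    (fun i => (((v + Pi.single b 1 - Pi.single a 1 : Fin m → ℤ) i : ℤ) : ℝ)) ∈
      convexHull ℝ (orbitR lam) := by
  classical
  have hne : a ≠ b := by rintro rfl; exact lt_irrefl _ hab
  have h2 := hull_perm lam (Equiv.swap a b) _ hv
  have hd : (0 : ℝ) < (v a : ℝ) - v b := by
    have : (v b : ℝ) < v a := by exact_mod_cast hab
    linarith
  have hd1 : (1 : ℝ) ≤ (v a : ℝ) - v b := by
    have : (v b : ℝ) + 1 ≤ v a := by exact_mod_cast hab
    linarith
  set c : ℝ := 1 / ((v a : ℝ) - v b) with hc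
  have hc0 : 0 ≤ c := by positivity
  have hc1 : c ≤ 1 := by rw [hc, div_le_one hd]; exact hd1
  have hcm : c * ((v a : ℝ) - v b) = 1 := by rw [hc]; field_simp
  have h3 := (convex_convexHull ℝ (orbitR lam)) hv h2 (sub_nonneg.mpr hc1) hc0 (by ring)
  convert h3 using 1
  funext i
  simp only [Pi.add_apply, Pi.smul_apply, smul_eq_mul, Pi.sub_apply]
  by_cases hia : i = a
  · subst hia
    simp [hne]
    linarith
  · by_cases hib : i = b
    · subst hib
      simp [hia]
      linarith
    · rw [Equiv.swap_apply_of_ne_of_ne hia hib]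
      simp [hia, hib]
      ring

lemma decompose {m t : ℕ} (nu : Fin t → Fin m → ℕ) (p : Fin m → ℤ)
    (h : ∀ S : Finset (Fin m), ∑ i ∈ S, p i ≤ ∑ j, ((pf S.card (nu j) : ℕ) : ℤ))
    (hs : ∑ i, p i = ∑ j, ((∑ i, nu j i : ℕ) : ℤ)) :
    ∃ v : Fin t → Fin m → ℤ, (∀ j, (fun i => (v j i : ℝ)) ∈ convexHull ℝ (orbitR (nu j))) ∧
      p = ∑ j, v j := by
  classical
  let Y : Set (Fin m → ℤ) := {y | ∃ v : Fin t → Fin m → ℤ,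
    (∀ j, (fun i => (v j i : ℝ)) ∈ convexHull ℝ (orbitR (nu j))) ∧ y = ∑ j, v j}
  let σ := Tuple.sort (fun i => - p i)
  have hanti : Antitone (p ∘ σ) := by
    intro a b hab
    have := Tuple.monotone_sort (fun i => - p i) hab
    simpa [σ] using this
  have hY : ∀ y ∈ Y, ∀ a b, y b < y a → (y + Pi.single b 1 - Pi.single a 1) ∈ Y := by
    rintro y ⟨v, hv, rfl⟩ a b hab
    simp only [Finset.sum_apply] at hab
    obtain ⟨j, _, hj⟩ := Finset.exists_lt_of_sum_lt hab
    refine ⟨Function.update v j (v j + Pi.single b 1 - Pi.single a 1), ?_, ?_⟩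
    · intro j'
      by_cases hjj : j' = j
      · subst hjj
        rw [Function.update_self]
        exact hull_transfer _ _ a b hj (hv j')
      · rw [Function.update_of_ne hjj]
        exact hv j'
    · rw [Finset.sum_update_of_mem (Finset.mem_univ j), ← Finset.add_sum_erase _ v (Finset.mem_univ j),
        Finset.sdiff_singleton_eq_erase]
      abel
  have hmem : p ∘ σ ∈ Y := by
    refine transfer Y hY (p ∘ σ) hanti _ (∑ j, fun i => (nu j i : ℤ)) ?_ ?_ ?_ le_rfl
    · refine ⟨fun j i => (nu j i : ℤ), ?_, rfl⟩
      intro j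
      apply subset_convexHull
      exact ⟨1, by simp⟩
    · intro k hk
      have h1 := h ((Finset.univ.filter (fun i : Fin m => (i : ℕ) < k)).map σ.toEmbedding)
      rw [Finset.sum_map, Finset.card_map, Fin.card_filter_val_lt, min_eq_right hk] at h1
      refine le_trans h1 (le_of_eq ?_)
      unfold pf
      simp only [Finset.sum_apply]
      rw [Finset.sum_comm]
      simp
    · simp only [Finset.sum_apply, Function.comp]
      rw [Equiv.sum_comp σ p, hs, Finset.sum_comm]
      simp
  obtain ⟨v, hv, hpv⟩ := hmem
  refine ⟨fun j i => v j (σ.symm i), fun j => hull_perm _ σ.symm _ (hv j), ?_⟩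
  funext i
  have := congrFun hpv (σ.symm i)
  simpa using this

/-! ### The chain -/

lemma chain_inv {m l : ℕ} (lam : ℕ → Fin m → ℕ) (hanti : ∀ i ≤ l, Antitone (lam i))
    (hstep : ∀ i < l, NorthmostStep (lam l) (lam i) (lam (i + 1))) :
    ∀ i ≤ l, lam 0 ≤ lam i ∧ lam i ≤ lam l ∧ (∑ k, lam i k = ∑ k, lam 0 k + i) ∧
      ∀ r, lam i r ≠ lam 0 r → ∀ r' < r, lam i r' = lam l r' := by
  classical
  have hle : ∀ i ≤ l, lam i ≤ lam l := by
    intro i hi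
    rcases lt_or_eq_of_le hi with h | h
    · obtain ⟨r, h1, _, h3, _⟩ := hstep i h
      refine le_trans ?_ h3
      rw [h1]
      intro x
      unfold AddBoxAt
      by_cases hx : x = r
      · subst hx; simp
      · simp [hx]
    · rw [h]
  intro i
  induction i with
  | zero =>
    intro hi
    exact ⟨le_rfl, hle 0 hi, by simp, fun r h => absurd rfl h⟩
  | succ i ih =>
    intro hi
    obtain ⟨g1, g2, g3, g4⟩ := ih (by omega)
    obtain ⟨r, h1, h2, h3, h4⟩ := hstep i hi
    have hr : lam (i+1) r = lam i r + 1 := by rw [h1]; simp [AddBoxAt]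
    have ho : ∀ x, x ≠ r → lam (i+1) x = lam i x := by
      intro x hx; rw [h1]; simp [AddBoxAt, hx]
    have key : ∀ r' < r, lam i r' = lam l r' := by
      by_contra hcon
      push Not at hcon
      have hne : (Finset.univ.filter (fun x => x < r ∧ lam i x ≠ lam l x)).Nonempty := by
        obtain ⟨x, hx⟩ := hcon
        exact ⟨x, by simp [hx]⟩
      obtain ⟨hq1, hq2⟩ := (Finset.mem_filter.mp (Finset.min'_mem _ hne)).2
      set q := Finset.min' _ hne with hq
      have hmin : ∀ x < q, lam i x = lam l x := by
        intro x hx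
        by_contra hlt
        have := Finset.min'_le (Finset.univ.filter (fun x => x < r ∧ lam i x ≠ lam l x)) x
          (by simp [hlt, lt_trans hx hq1])
        exact absurd hx (not_lt.mpr this)
      have hqlt : lam i q + 1 ≤ lam l q := lt_of_le_of_ne (g2 q) hq2
      refine h4 q hq1 ⟨?_, ?_⟩
      · intro x y hxy
        have hA := hanti i (by omega) hxy
        have hB := hanti l le_rfl hxy
        unfold AddBoxAt
        by_cases hy : y = q
        · rw [hy] at hxy hA hB ⊢
          by_cases hx : x = q
          · rw [hx]
          · have := hmin x (lt_of_le_of_ne hxy hx)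
            rw [Function.update_self, Function.update_of_ne hx]; omega
        · by_cases hx : x = q
          · rw [hx, Function.update_self, Function.update_of_ne hy]; rw [hx] at hA; omega
          · rw [Function.update_of_ne hx, Function.update_of_ne hy]; exact hA
      · intro x
        unfold AddBoxAt
        by_cases hx : x = q
        · rw [hx]; simpa using hqlt
        · simpa [hx] using g2 x
    refine ⟨?_, hle _ hi, ?_, ?_⟩
    · intro x
      by_cases hx : x = r
      · rw [hx, hr]; exact Nat.le_succ_of_le (g1 r)
      · rw [ho x hx]; exact g1 x
    · rw [h1, AddBoxAt, Finset.sum_update_of_mem (Finset.mem_univ r),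
        ← add_assoc, ← g3, ← Finset.add_sum_erase _ (lam i) (Finset.mem_univ r),
        Finset.sdiff_singleton_eq_erase]
      ring
    · intro x hx x' hx'
      have hxr : x ≤ r := by
        by_contra hlt
        push Not at hlt
        rw [ho x hlt.ne'] at hx
        have := g4 x hx r hlt
        have : lam (i+1) r ≤ lam l r := h3 r
        omega
      have hlt : x' < r := lt_of_lt_of_le hx' hxr
      have hkey := key x' hlt
      rw [ho x' hlt.ne]
      exact hkey

/-- sum of the entries from `k` on -/
def sf {m : ℕ} (k : ℕ) (f : Fin m → ℕ) : ℕ :=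
  ∑ i ∈ Finset.univ.filter (fun i : Fin m => ¬ (i : ℕ) < k), f i

lemma pf_add_sf {m : ℕ} (k : ℕ) (f : Fin m → ℕ) : pf k f + sf k f = ∑ i, f i :=
  Finset.sum_filter_add_sum_filter_not _ _ _

lemma chain_pf {m l : ℕ} (lam : ℕ → Fin m → ℕ) (hanti : ∀ i ≤ l, Antitone (lam i))
    (hstep : ∀ i < l, NorthmostStep (lam l) (lam i) (lam (i + 1))) (i : ℕ) (hi : i ≤ l) (k : ℕ) :
    pf k (lam i) ≤ pf k (lam l) ∧ pf k (lam i) ≤ pf k (lam 0) + i ∧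
    (pf k (lam i) = pf k (lam l) ∨ pf k (lam i) = pf k (lam 0) + i) := by
  obtain ⟨g1, g2, g3, g4⟩ := chain_inv lam hanti hstep i hi
  have e1 := pf_add_sf k (lam i)
  have e0 := pf_add_sf k (lam 0)
  have s1 : sf k (lam 0) ≤ sf k (lam i) := Finset.sum_le_sum fun x _ => g1 x
  refine ⟨Finset.sum_le_sum fun x _ => g2 x, by omega, ?_⟩
  by_cases hh : ∃ r : Fin m, k ≤ (r : ℕ) ∧ lam i r ≠ lam 0 r
  · left
    obtain ⟨r, hr, hr2⟩ := hh
    apply Finset.sum_congr rfl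
    intro x hx
    have hx' : (x : ℕ) < k := (Finset.mem_filter.mp hx).2
    exact g4 r hr2 x (by rw [Fin.lt_def]; omega)
  · right
    push Not at hh
    have : sf k (lam i) = sf k (lam 0) := by
      apply Finset.sum_congr rfl
      intro x hx
      have hx' : ¬ (x : ℕ) < k := (Finset.mem_filter.mp hx).2
      exact hh x (by omega)
    omega

lemma dominates_pf {m : ℕ} (a b : Fin m → ℕ) (h : Dominates a b) (k : ℕ) (hk : k ≤ m) :
    pf k a ≤ pf k b := by
  rcases Nat.eq_zero_or_pos k with rfl | hpos
  · simp [pf]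
  · have := h ⟨k - 1, by omega⟩
    have e : (Finset.univ.filter (fun i : Fin m => (i : ℕ) < k)) =
        Finset.univ.filter (· ≤ (⟨k - 1, by omega⟩ : Fin m)) := by
      ext x
      simp only [Finset.mem_filter, Finset.mem_univ, true_and, Fin.le_def]
      omega
    unfold pf
    rw [e]
    exact this

/-- A *good* linear combination of Schur polynomials has a Newton polytope with the integer decomposition property.
Here `F = ∑ j, C j • s_{μ j}` with all `C j ≠ 0`;
condition (a): for each degree `d`, the support of the degree-`d` part of `F` is the union of
the supports of the Schur polynomials appearing in degree `d`;
condition (b): for each degree appearing there is a dominance-maximum partition `lam i`, these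
appear in `F`, and they form a chain `lam 0 < lam 1 < … < lam l` in which each term is obtained
from the previous one by adding a box in the northmost admissible row (keeping a partition
`≤ lam l`). -/
theorem good_newton_hasIDP (m l : ℕ) (ι : Type) [Fintype ι]
    (C : ι → ℝ) (hC : ∀ j, C j ≠ 0)
    (μ : ι → Fin m → ℕ) (hμ : ∀ j, Antitone (μ j))
    (F : (Fin m → ℕ) → ℝ)
    (hF : F = fun α => ∑ j, C j * (schurCoeff m (diagramOf (μ j) (hμ j)) α : ℝ))
    -- condition (a)
    (ha : ∀ d : ℕ, {α : Fin m → ℕ | (∑ k, α k) = d ∧ F α ≠ 0} =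
      ⋃ j ∈ {j : ι | ∑ k, μ j k = d}, {α | schurCoeff m (diagramOf (μ j) (hμ j)) α ≠ 0})
    -- condition (b)
    (lam : ℕ → Fin m → ℕ) (hanti : ∀ i ≤ l, Antitone (lam i))
    (hdeg : ∀ j : ι, ∃ i ≤ l, (∑ k, μ j k) = (∑ k, lam i k))
    (happ : ∀ i ≤ l, ∃ j : ι, μ j = lam i)
    (hmax : ∀ i ≤ l, ∀ j : ι, (∑ k, μ j k) = (∑ k, lam i k) → Dominates (μ j) (lam i))
    (hstep : ∀ i < l, NorthmostStep (lam l) (lam i) (lam (i + 1))) :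
    HasIDP (NewtonP F) := by
  classical
  have hfdeg : ∀ i ≤ l, ∑ k, lam i k = ∑ k, lam 0 k + i :=
    fun i hi => (chain_inv lam hanti hstep i hi).2.2.1
  have hchain := chain_pf lam hanti hstep
  -- permutohedra of the chain are contained in the Newton polytope
  have hsub : ∀ i ≤ l, convexHull ℝ (orbitR (lam i)) ⊆ NewtonP F := by
    intro i hi
    apply convexHull_mono
    rintro _ ⟨σ, rfl⟩
    obtain ⟨j, hj⟩ := happ i hi
    refine ⟨fun k => lam i (σ k), ?_, rfl⟩
    have hmem : (fun k => lam i (σ k)) ∈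
        {α : Fin m → ℕ | (∑ k, α k) = ∑ k, lam i k ∧ F α ≠ 0} := by
      rw [ha (∑ k, lam i k)]
      simp only [Set.mem_iUnion]
      refine ⟨j, by simp [hj], ?_⟩
      have := schurCoeff_perm (μ j) (hμ j) σ
      rw [← hj]
      exact this
    exact hmem.2
  -- the Newton polytope satisfies the inequalities
  let Q : Set (Fin m → ℝ) := {x | (∀ S : Finset (Fin m),
      ∑ k ∈ S, x k ≤ (pf S.card (lam l) : ℕ) ∧
      ∑ k ∈ S, x k ≤ (pf S.card (lam 0) : ℕ) + (∑ k, x k - (∑ k, lam 0 k : ℕ))) ∧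
      ((∑ k, lam 0 k : ℕ) : ℝ) ≤ ∑ k, x k ∧ ∑ k, x k ≤ (∑ k, lam 0 k : ℕ) + (l : ℝ)}
  have hQ : NewtonP F ⊆ Q := by
    apply convexHull_min
    · rintro _ ⟨α, hα, rfl⟩
      have hmem : α ∈ {β : Fin m → ℕ | (∑ k, β k) = ∑ k, α k ∧ F β ≠ 0} := ⟨rfl, hα⟩
      rw [ha (∑ k, α k)] at hmem
      simp only [Set.mem_iUnion] at hmem
      obtain ⟨j, hj, hne⟩ := hmem
      have hj' : ∑ k, μ j k = ∑ k, α k := hj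
      obtain ⟨i, hi, hij⟩ := hdeg j
      have hdom := hmax i hi j hij
      have hd := hfdeg i hi
      have hαd : ∑ k, α k = ∑ k, lam 0 k + i := by omega
      refine ⟨fun S => ?_, ?_, ?_⟩
      · have h1 := content_le (μ j) (hμ j) α hne S
        have h2 := dominates_pf _ _ hdom S.card (by simpa using Finset.card_le_univ S)
        obtain ⟨h3, h4, _⟩ := hchain i hi S.card
        have e1 : ∑ k ∈ S, α k ≤ pf S.card (lam l) := by omega
        have e2 : ∑ k ∈ S, α k + ∑ k, lam 0 k ≤ pf S.card (lam 0) + ∑ k, α k := by omega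
        constructor
        · simp only []
          exact_mod_cast e1
        · have e2' : ((∑ k ∈ S, α k : ℕ) : ℝ) + (∑ k, lam 0 k : ℕ) ≤
            (pf S.card (lam 0) : ℕ) + (∑ k, α k : ℕ) := by exact_mod_cast e2
          push_cast at e2' ⊢
          linarith
      · have : ∑ k, lam 0 k ≤ ∑ k, α k := by omega
        simp only []
        exact_mod_cast this
      · have : ∑ k, α k ≤ ∑ k, lam 0 k + l := by omega
        simp only []
        exact_mod_cast this
    · intro x hx y hy a b ha0 hb0 hab
      obtain ⟨hx1, hx2, hx3⟩ := hx
      obtain ⟨hy1, hy2, hy3⟩ := hy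
      have hsum : ∀ S : Finset (Fin m), ∑ k ∈ S, (a • x + b • y) k =
          a * ∑ k ∈ S, x k + b * ∑ k ∈ S, y k := by
        intro S
        simp [Finset.sum_add_distrib, Finset.mul_sum]
      have hb' : b = 1 - a := by linarith
      refine ⟨fun S => ⟨?_, ?_⟩, ?_, ?_⟩
      · rw [hsum]
        have u1 := mul_le_mul_of_nonneg_left (hx1 S).1 ha0
        have u2 := mul_le_mul_of_nonneg_left (hy1 S).1 hb0
        refine (add_le_add u1 u2).trans (le_of_eq ?_)
        rw [← add_mul, hab, one_mul]
      · rw [hsum, hsum]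
        have u1 := mul_le_mul_of_nonneg_left (hx1 S).2 ha0
        have u2 := mul_le_mul_of_nonneg_left (hy1 S).2 hb0
        refine (add_le_add u1 u2).trans (le_of_eq ?_)
        rw [hb']; ring
      · rw [hsum]
        have u1 := mul_le_mul_of_nonneg_left hx2 ha0
        have u2 := mul_le_mul_of_nonneg_left hy2 hb0
        refine le_trans (le_of_eq ?_) (add_le_add u1 u2)
        rw [← add_mul, hab, one_mul]
      · rw [hsum]
        have u1 := mul_le_mul_of_nonneg_left hx3 ha0
        have u2 := mul_le_mul_of_nonneg_left hy3 hb0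
        refine (add_le_add u1 u2).trans (le_of_eq ?_)
        rw [← add_mul, hab, one_mul]
  intro t ht p hp hlat
  obtain ⟨x, hx, rfl⟩ := hp
  choose z hz using hlat
  obtain ⟨hx1, hx2, hx3⟩ := hQ hx
  have ht' : (0 : ℝ) ≤ t := Nat.cast_nonneg t
  have hzS : ∀ S : Finset (Fin m), ((∑ k ∈ S, z k : ℤ) : ℝ) = t * ∑ k ∈ S, x k := by
    intro S
    push_cast
    rw [Finset.mul_sum]
    apply Finset.sum_congr rfl
    intro k _
    rw [← hz k]; simp
  have z1 : ∀ S : Finset (Fin m), ∑ k ∈ S, z k ≤ t * (pf S.card (lam l) : ℕ) := by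
    intro S
    have := mul_le_mul_of_nonneg_left (hx1 S).1 ht'
    rw [← hzS] at this
    exact_mod_cast this
  have z2 : ∀ S : Finset (Fin m), ∑ k ∈ S, z k ≤
      t * (pf S.card (lam 0) : ℕ) + (∑ k, z k - t * (∑ k, lam 0 k : ℕ)) := by
    intro S
    have := mul_le_mul_of_nonneg_left (hx1 S).2 ht'
    rw [mul_add, mul_sub, ← hzS, ← hzS] at this
    exact_mod_cast this
  have z3 : (t : ℤ) * (∑ k, lam 0 k : ℕ) ≤ ∑ k, z k := by
    have := mul_le_mul_of_nonneg_left hx2 ht'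
    rw [← hzS] at this
    exact_mod_cast this
  have z4 : ∑ k, z k ≤ (t : ℤ) * (∑ k, lam 0 k : ℕ) + t * l := by
    have := mul_le_mul_of_nonneg_left hx3 ht'
    rw [mul_add, ← hzS] at this
    exact_mod_cast this
  obtain ⟨n, hn⟩ : ∃ n : ℕ, ∑ k, z k = (t : ℤ) * (∑ k, lam 0 k : ℕ) + n :=
    ⟨(∑ k, z k - (t : ℤ) * (∑ k, lam 0 k : ℕ)).toNat, by
      rw [Int.toNat_of_nonneg (by linarith)]; ring⟩
  have hnl : n ≤ t * l := by
    have : (n : ℤ) ≤ t * l := by linarith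
    exact_mod_cast this
  have hdm := Nat.div_add_mod n t
  have hrt := Nat.mod_lt n ht
  set q := n / t with hq
  set r := n % t with hr
  let idx : Fin t → ℕ := fun j => q + if (j : ℕ) < r then 1 else 0
  have hidx : ∀ j, idx j ≤ l := by
    intro j
    by_cases hj : (j : ℕ) < r
    · simp only [idx, if_pos hj]
      by_contra hlt
      have : t * l ≤ t * q := Nat.mul_le_mul_left t (by omega)
      omega
    · simp only [idx, if_neg hj, add_zero]
      by_contra hlt
      have : t * (l + 1) ≤ t * q := Nat.mul_le_mul_left t (by omega)
      rw [mul_add] at this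
      omega
  have hidxsum : ∑ j, idx j = n := by
    simp only [idx, Finset.sum_add_distrib, Finset.sum_const, Finset.card_univ, Fintype.card_fin,
      smul_eq_mul, Finset.sum_boole, Fin.card_filter_val_lt, Nat.cast_id]
    rw [min_eq_right hrt.le]
    exact hdm
  have hcast : ∑ j, (idx j : ℤ) = n := by exact_mod_cast hidxsum
  obtain ⟨v, hv, hzv⟩ := decompose (fun j => lam (idx j)) z (by
    intro S
    set k := S.card
    by_cases hcase : ∀ j, pf k (lam (idx j)) = pf k (lam l)
    · refine (z1 S).trans (le_of_eq ?_)
      simp only [hcase]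
      simp [k]
    · have hall : ∀ j, pf k (lam (idx j)) = pf k (lam 0) + idx j := by
        push Not at hcase
        obtain ⟨j0, hj0⟩ := hcase
        intro j
        obtain ⟨a1, a2, a3⟩ := hchain (idx j0) (hidx j0) k
        obtain ⟨b1, b2, b3⟩ := hchain (idx j) (hidx j) k
        have hjj : idx j ≤ idx j0 + 1 := by
          simp only [idx]
          split_ifs <;> omega
        omega
      refine (z2 S).trans (le_of_eq ?_)
      simp only [hall]
      rw [hn]
      push_cast
      rw [Finset.sum_add_distrib, hcast]
      simp [k]) (by
    simp only [fun j => hfdeg (idx j) (hidx j)]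
    rw [hn]
    push_cast
    rw [Finset.sum_add_distrib, hcast]
    simp)
  refine ⟨fun j i => (v j i : ℝ), fun j => ⟨hsub _ (hidx j) (hv j), fun i => ⟨v j i, rfl⟩⟩, ?_⟩
  funext i
  have := congrFun hzv i
  have h2 := hz i
  rw [this] at h2
  simp only [Finset.sum_apply] at h2 ⊢
  push_cast at h2
  exact h2
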